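/- arXiv:1707.01289 — 3 statements merged into one kernel-verified Lean document; each statement's English description precedes it below -/
import Mathlib

section
/- Under the hypotheses listed in the context, for a pair (z, y) ∈ C ⊕ QZ one has π(z) + i(y) = 0 if and only if there exists u ∈ Q with z = −j(u) and y = p(u). In other words, the kernel of the homomorphism (z, y) ↦ π(z) + i(y) equals the image of the homomorphism Q → C ⊕ QZ, u ↦ (−j(u), p(u)). -/
/-- Exactness part of the diagram chase in Segal's construction of K-theory
with ℂ/ℤ coefficients: under the listed hypotheses, the kernel of
`(z, y) ↦ π z + i y` is exactly the image of `u ↦ (−j u, p u)`. -/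
theorem ker_pi_add_i_eq_im
    {Z Q C QZ CZ Z' : Type*}
    [AddCommGroup Z] [AddCommGroup Q] [AddCommGroup C]
    [AddCommGroup QZ] [AddCommGroup CZ] [AddCommGroup Z']
    (k : Z →+ Q) (j : Q →+ C) (p : Q →+ QZ)
    (π : C →+ CZ) (i : QZ →+ CZ) (δ : QZ →+ Z') (δ' : CZ →+ Z')
    (ha : ∀ u : Q, π (j u) = i (p u))
    (hb : ∀ y : QZ, δ' (i y) = δ y)
    (hc : ∀ z : C, δ' (π z) = 0)
    (hd : ∀ y : QZ, δ y = 0 → ∃ u : Q, p u = y)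
    (he : ∀ z : C, π z = 0 → ∃ v : Z, j (k v) = z)
    (hf : ∀ v : Z, p (k v) = 0) :
    ∀ (z : C) (y : QZ), π z + i y = 0 ↔ ∃ u : Q, z = -(j u) ∧ y = p u := by
  intro z y
  constructor
  · intro h
    have h1 : δ y = 0 := by
      have h2 := congrArg δ' h
      rwa [map_add, hc, hb, zero_add, map_zero] at h2
    obtain ⟨u, rfl⟩ := hd y h1
    obtain ⟨v, hv⟩ := he (z + j u) (by rw [map_add, ha, h])
    refine ⟨u - k v, ?_, ?_⟩
    · rw [map_sub, hv]; abel
    · rw [map_sub, hf, sub_zero]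
  · rintro ⟨u, rfl, rfl⟩
    rw [map_neg, ha, neg_add_cancel]
end

section
/- Let p be a positive integer and let q, s, d be integers such that q is coprime to 2p and d·q ≡ 1 (mod 2p). Then the complex number (1/p) · Σ_{k=1}^{p−1} (exp(2πiks/p) − 1) · exp(πik/p) · exp(πikq/p) / ((exp(2πik/p) − 1)(exp(2πikq/p) − 1)) + d·s²/(2p) + d·s/2 is an integer (i.e., it lies in ℤ ⊆ ℂ). (Note that the denominators are nonzero: since gcd(q, p) = 1 and 1 ≤ k ≤ p−1, neither k nor kq is divisible by p.) -/
open Complex Finset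

/-- Rewritten exponential sum. -/
noncomputable def xiSum (p : ℕ) (z : ℂ) (q h s : ℤ) : ℂ :=
  ∑ k ∈ Finset.Icc 1 (p - 1), ((z ^ k) ^ s - 1) * (z ^ k) ^ h / ((z ^ k - 1) * ((z ^ k) ^ q - 1))

lemma xi_ne (p : ℕ) (z : ℂ) (hz : IsPrimitiveRoot z p) (q : ℤ)
    (hq : IsCoprime q (p : ℤ)) (k : ℕ) (hk : k ∈ Finset.Icc 1 (p - 1)) :
    (z ^ k) ^ q - 1 ≠ 0 := by
  rw [Finset.mem_Icc] at hk
  intro h0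
  have h1 : z ^ ((k : ℤ) * q) = 1 := by
    rw [zpow_mul, zpow_natCast]; exact sub_eq_zero.mp h0
  rw [hz.zpow_eq_one_iff_dvd] at h1
  have h2 : (p : ℤ) ∣ k := hq.symm.dvd_of_dvd_mul_right h1
  have h3 : p ∣ k := by exact_mod_cast h2
  have := Nat.le_of_dvd (by omega) h3
  omega

lemma xi_ne1 (p : ℕ) (z : ℂ) (hz : IsPrimitiveRoot z p) (k : ℕ)
    (hk : k ∈ Finset.Icc 1 (p - 1)) : z ^ k - 1 ≠ 0 := by
  have := xi_ne p z hz 1 isCoprime_one_left k hk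
  simpa using this

lemma xi_geom (p : ℕ) (hp : 0 < p) (z : ℂ) (hz : IsPrimitiveRoot z p) (a : ℤ) :
    ∃ m : ℤ, ∑ k ∈ Finset.Icc 1 (p - 1), (z ^ k) ^ a = p * m - 1 := by
  have hr : ∑ k ∈ Finset.range p, (z ^ a) ^ k = 1 + ∑ k ∈ Finset.Icc 1 (p - 1), (z ^ k) ^ a := by
    obtain ⟨n, rfl⟩ : ∃ n, p = n + 1 := ⟨p - 1, by omega⟩
    rw [Finset.sum_range_succ', add_comm, pow_zero, Nat.add_sub_cancel]
    congr 1
    rw [Finset.range_eq_Ico, Finset.sum_Ico_add' (fun k => (z ^ a) ^ k) 0 n 1]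
    apply Finset.sum_congr
    · ext; simp
    · intro k _
      rw [← zpow_natCast, ← zpow_natCast, ← zpow_mul, ← zpow_mul, mul_comm]
  by_cases h1 : z ^ a = 1
  · refine ⟨1, ?_⟩
    rw [h1] at hr
    simp at hr
    rw [hr]; push_cast; ring
  · refine ⟨0, ?_⟩
    have h2 : (z ^ a) ^ p = 1 := by
      rw [← zpow_natCast, ← zpow_mul, mul_comm, zpow_mul, zpow_natCast, hz.pow_eq_one, one_zpow]
    rw [geom_sum_eq h1, h2] at hr
    simp at hr
    push_cast
    linear_combination -hr

lemma xi_half (p : ℕ) (hp : 0 < p) (z : ℂ) (hz : IsPrimitiveRoot z p) :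
    ∑ k ∈ Finset.Icc 1 (p - 1), 1 / (z ^ k - 1) = -((p : ℂ) - 1) / 2 := by
  have hrefl : ∑ k ∈ Finset.Icc 1 (p - 1), 1 / (z ^ k - 1)
      = ∑ k ∈ Finset.Icc 1 (p - 1), 1 / (z ^ (p - k) - 1) := by
    refine Finset.sum_bij' (fun k _ => p - k) (fun k _ => p - k) ?_ ?_ ?_ ?_ ?_
    · intro k hk; rw [Finset.mem_Icc] at *; omega
    · intro k hk; rw [Finset.mem_Icc] at *; omega
    · intro k hk; rw [Finset.mem_Icc] at *; omega
    · intro k hk; rw [Finset.mem_Icc] at *; omega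
    · intro k hk
      rw [Finset.mem_Icc] at hk
      rw [show p - (p - k) = k by omega]
  have hs : ∑ k ∈ Finset.Icc 1 (p - 1), 1 / (z ^ k - 1)
      + ∑ k ∈ Finset.Icc 1 (p - 1), 1 / (z ^ (p - k) - 1) = -((p : ℂ) - 1) := by
    rw [← Finset.sum_add_distrib]
    have : ∀ k ∈ Finset.Icc 1 (p - 1), 1 / (z ^ k - 1) + 1 / (z ^ (p - k) - 1) = (-1 : ℂ) := by
      intro k hk
      have ha := xi_ne1 p z hz k hk
      have hb := xi_ne1 p z hz (p - k) (by rw [Finset.mem_Icc] at *; omega)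
      have hm : z ^ k * z ^ (p - k) = 1 := by
        rw [← pow_add, ← hz.pow_eq_one]
        rw [Finset.mem_Icc] at hk
        congr 1; omega
      generalize z ^ k = x at *
      generalize z ^ (p - k) = y at *
      field_simp
      linear_combination hm
    rw [Finset.sum_congr rfl this]
    simp [Nat.cast_sub (show 1 ≤ p from hp)]
  rw [← hrefl] at hs
  linear_combination hs / 2

lemma xi_diff (p : ℕ) (z : ℂ) (hz : IsPrimitiveRoot z p) (q h s : ℤ) (hz0 : z ≠ 0)
    (hq : IsCoprime q (p : ℤ)) :
    xiSum p z q h (s + q) - xiSum p z q h s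
      = ∑ k ∈ Finset.Icc 1 (p - 1), (z ^ k) ^ (s + h) / (z ^ k - 1) := by
  unfold xiSum
  rw [← Finset.sum_sub_distrib]
  refine Finset.sum_congr rfl fun k hk => ?_
  have ha := xi_ne1 p z hz k hk
  have hb := xi_ne p z hz q hq k hk
  have hx : z ^ k ≠ 0 := pow_ne_zero _ hz0
  rw [zpow_add₀ hx, zpow_add₀ hx]
  field_simp
  ring

lemma xi_diff2 (p : ℕ) (hp : 0 < p) (z : ℂ) (hz : IsPrimitiveRoot z p) (q h s : ℤ) (hz0 : z ≠ 0)
    (hq : IsCoprime q (p : ℤ)) :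
    ∃ m : ℤ, (xiSum p z q h (s + 1 + q) - xiSum p z q h (s + 1))
      - (xiSum p z q h (s + q) - xiSum p z q h s) = p * m - 1 := by
  obtain ⟨m, hm⟩ := xi_geom p hp z hz (s + h)
  refine ⟨m, ?_⟩
  rw [← hm, xi_diff p z hz q h _ hz0 hq, xi_diff p z hz q h _ hz0 hq, ← Finset.sum_sub_distrib]
  refine Finset.sum_congr rfl fun k hk => ?_
  have ha := xi_ne1 p z hz k hk
  have hx : z ^ k ≠ 0 := pow_ne_zero _ hz0
  rw [show s + 1 + h = s + h + 1 by ring, zpow_add_one₀ hx]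
  field_simp

lemma xi_per (p : ℕ) (z : ℂ) (hz : IsPrimitiveRoot z p) (q h s : ℤ) (hz0 : z ≠ 0) :
    xiSum p z q h (s + p) = xiSum p z q h s := by
  unfold xiSum
  refine Finset.sum_congr rfl fun k hk => ?_
  have hx : z ^ k ≠ 0 := pow_ne_zero _ hz0
  have : (z ^ k) ^ p = 1 := by rw [← pow_mul, mul_comm, pow_mul, hz.pow_eq_one, one_pow]
  rw [zpow_add₀ hx, zpow_natCast, this, mul_one]

/-- If integer differences along step `a`, integrality propagates. -/
lemma xi_prop (G : ℤ → ℂ) (a : ℤ) (hG : ∀ s, ∃ m : ℤ, G (s + a) - G s = m) (s n : ℤ) :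
    ∃ m : ℤ, G (s + n * a) - G s = m := by
  induction n using Int.induction_on with
  | zero => exact ⟨0, by simp⟩
  | succ i ih =>
    obtain ⟨m, hm⟩ := ih
    obtain ⟨m', hm'⟩ := hG (s + i * a)
    refine ⟨m + m', ?_⟩
    rw [show s + ((i : ℤ) + 1) * a = s + i * a + a by ring]
    push_cast; linear_combination hm + hm'
  | pred i ih =>
    obtain ⟨m, hm⟩ := ih
    obtain ⟨m', hm'⟩ := hG (s + (-i - 1) * a)
    refine ⟨m - m', ?_⟩
    rw [show s + (-(i : ℤ) - 1) * a + a = s + -i * a by ring] at hm'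
    push_cast; linear_combination hm - hm'

lemma xi_core (p : ℕ) (hp : 0 < p) (z : ℂ) (hz : IsPrimitiveRoot z p) (q h s d t : ℤ)
    (hq : IsCoprime q (p : ℤ)) (hh : q = 2 * h - 1) (hd : d * q = 1 + 2 * p * t) :
    ∃ m : ℤ, (1 / (p : ℂ)) * xiSum p z q h s + (d : ℂ) * (s : ℂ) ^ 2 / (2 * (p : ℂ))
      + (d : ℂ) * (s : ℂ) / 2 = m := by
  have hz0 : z ≠ 0 := hz.ne_zero (by omega)
  have hp0 : (p : ℂ) ≠ 0 := by exact_mod_cast hp.ne'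
  have hdc : (d : ℂ) * q = 1 + 2 * p * t := by exact_mod_cast hd
  have hhc : (q : ℂ) = 2 * h - 1 := by exact_mod_cast hh
  set G : ℤ → ℂ := fun s => (1 / (p : ℂ)) * xiSum p z q h s + (d : ℂ) * (s : ℂ) ^ 2 / (2 * (p : ℂ))
      + (d : ℂ) * (s : ℂ) / 2 with hGdef
  have h2 : ∀ s, ∃ m : ℤ, (fun s => G (s + q) - G s) (s + 1) - (fun s => G (s + q) - G s) s = m := by
    intro s
    obtain ⟨m, hm⟩ := xi_diff2 p hp z hz q h s hz0 hq
    refine ⟨m + 2 * t, ?_⟩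
    simp only [hGdef]
    push_cast
    field_simp
    linear_combination 2 * hm + 2 * hdc
  have h3 : ∃ m : ℤ, G (-h + q) - G (-h) = m := by
    have hm := xi_diff p z hz q h (-h) hz0 hq
    have hm2 : xiSum p z q h (-h + q) - xiSum p z q h (-h) = -((p : ℂ) - 1) / 2 := by
      rw [hm, ← xi_half p hp z hz]
      simp
    refine ⟨-t + p * t, ?_⟩
    simp only [hGdef]
    push_cast
    field_simp
    have e : (d : ℂ) * (-h + q) ^ 2 - d * h ^ 2 = - (d * q) := by rw [hhc]; ring
    linear_combination 2 * hm2 + e + (p - 1) * hdc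
  have h4 : ∀ s, ∃ m : ℤ, G (s + q) - G s = m := by
    intro s
    obtain ⟨m, hm⟩ := xi_prop (fun s => G (s + q) - G s) 1 h2 (-h) (s + h)
    obtain ⟨m', hm'⟩ := h3
    refine ⟨m + m', ?_⟩
    simp only [show -h + (s + h) * 1 = s by ring] at hm
    push_cast; linear_combination hm + hm'
  have h5 : ∀ s, ∃ m : ℤ, G (s + p) - G s = m := by
    intro s
    refine ⟨d * s + d * p, ?_⟩
    simp only [hGdef, xi_per p z hz q h s hz0]
    push_cast
    field_simp
    ring
  have h0 : G 0 = 0 := by simp [hGdef, xiSum]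
  obtain ⟨m, hm⟩ := xi_prop G q h4 0 (d * s)
  obtain ⟨m', hm'⟩ := xi_prop G p h5 (0 + d * s * q) (-(2 * t * s))
  refine ⟨m + m', ?_⟩
  rw [show 0 + d * s * q + -(2 * t * s) * (p : ℤ) = s by linear_combination s * hd] at hm'
  change G s = _
  push_cast; linear_combination hm + hm' + h0


/-- The ξ̃-invariant of the lens space `L(p,q)` twisted by the character `ρ_s`,
computed by Donnelly's fixed point theorem as an exponential sum, satisfies
`ξ̃(ρ_s, L(p,q)) ≡ −d·s²/(2p) − d·s/2 (mod ℤ)` whenever `d·q ≡ 1 (mod 2p)`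
and `q` is coprime to `2p`. -/
theorem xi_lens_space_formula
    (p : ℕ) (hp : 0 < p) (q s d : ℤ)
    (hq : IsCoprime q (2 * (p : ℤ)))
    (hd : d * q ≡ 1 [ZMOD (2 * (p : ℤ))]) :
    ∃ m : ℤ,
      (1 / (p : ℂ)) *
        (∑ k ∈ Finset.Icc 1 (p - 1),
          (Complex.exp (2 * Real.pi * Complex.I * (k : ℂ) * (s : ℂ) / (p : ℂ)) - 1) *
            (Complex.exp (Real.pi * Complex.I * (k : ℂ) / (p : ℂ)) *
              Complex.exp (Real.pi * Complex.I * (k : ℂ) * (q : ℂ) / (p : ℂ))) /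
          ((Complex.exp (2 * Real.pi * Complex.I * (k : ℂ) / (p : ℂ)) - 1) *
            (Complex.exp (2 * Real.pi * Complex.I * (k : ℂ) * (q : ℂ) / (p : ℂ)) - 1)))
      + (d : ℂ) * (s : ℂ) ^ 2 / (2 * (p : ℂ)) + (d : ℂ) * (s : ℂ) / 2
      = (m : ℂ) := by
  have hodd : ∃ h : ℤ, q = 2 * h - 1 := by
    obtain ⟨a, b, hab⟩ := hq
    rcases Int.even_or_odd q with ⟨c, hc⟩ | ⟨c, hc⟩
    · exfalso
      have : 2 * (a * c + b * p) = 1 := by rw [← hab, hc]; ring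
      omega
    · exact ⟨c + 1, by omega⟩
  obtain ⟨h, hh⟩ := hodd
  obtain ⟨t, ht⟩ := hd.symm.dvd
  have hz := Complex.isPrimitiveRoot_exp p hp.ne'
  have hp0 : (p : ℂ) ≠ 0 := by exact_mod_cast hp.ne'
  have key := xi_core p hp _ hz q h s d t hq.of_mul_right_right hh (by linear_combination ht)
  have hpow : ∀ (k : ℕ) (a : ℤ), (Complex.exp (2 * Real.pi * Complex.I / p) ^ k) ^ a
      = Complex.exp (2 * Real.pi * Complex.I * (k : ℂ) * (a : ℂ) / (p : ℂ)) := by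
    intro k a
    rw [← Complex.exp_nat_mul, ← Complex.exp_int_mul]
    congr 1; ring
  have hS : xiSum p (Complex.exp (2 * Real.pi * Complex.I / p)) q h s =
      ∑ k ∈ Finset.Icc 1 (p - 1),
          (Complex.exp (2 * Real.pi * Complex.I * (k : ℂ) * (s : ℂ) / (p : ℂ)) - 1) *
            (Complex.exp (Real.pi * Complex.I * (k : ℂ) / (p : ℂ)) *
              Complex.exp (Real.pi * Complex.I * (k : ℂ) * (q : ℂ) / (p : ℂ))) /
          ((Complex.exp (2 * Real.pi * Complex.I * (k : ℂ) / (p : ℂ)) - 1) *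
            (Complex.exp (2 * Real.pi * Complex.I * (k : ℂ) * (q : ℂ) / (p : ℂ)) - 1)) := by
    unfold xiSum
    refine Finset.sum_congr rfl fun k _ => ?_
    rw [hpow, hpow, hpow, ← Complex.exp_add, ← Complex.exp_nat_mul]
    have e1 : (k : ℂ) * (2 * Real.pi * Complex.I / p) = 2 * Real.pi * Complex.I * (k : ℂ) / (p : ℂ) := by
      ring
    have e2 : Real.pi * Complex.I * (k : ℂ) / (p : ℂ) + Real.pi * Complex.I * (k : ℂ) * (q : ℂ) / (p : ℂ)
        = 2 * Real.pi * Complex.I * (k : ℂ) * (h : ℂ) / (p : ℂ) := by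
      rw [hh]; push_cast; ring
    rw [e1, e2]
  rw [hS] at key
  exact key
end

section
/- Let a_1, …, a_n be pairwise coprime positive integers, let a = a_1⋯a_n, and let b, b_1, …, b_n be integers satisfying the Seifert relation −a·b + Σ_{j=1}^n (a/a_j)·b_j = 1. For each i let b_i' be an integer with b_i'·b_i ≡ 1 (mod 2a_i). Let N be a positive integer and let s_k(i) be integers for 1 ≤ k ≤ N and 1 ≤ i ≤ n. Then the rational number Σ_{i=1}^n Σ_{1 ≤ k < l ≤ N} ( b_i'·(s_k(i) − s_l(i))²/a_i − a·(s_k(i) − s_l(i))²/a_i² ) is an integer; i.e., Σ_{i} Σ_{k<l} b_i'(s_k(i) − s_l(i))²/a_i ≡ Σ_{i} Σ_{k<l} a·(s_k(i) − s_l(i))²/a_i² (mod ℤ). -/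
open Finset

/-- Final arithmetic step in the computation of `2N·Re(e_*[Σ(a₁,…,aₙ), ρ])`:
with the Seifert homology-sphere relation and `bᵢ'` an inverse of `bᵢ` modulo
`2aᵢ`, the difference
`Σᵢ Σ_{k<l} bᵢ'(s_k(i) − s_l(i))²/aᵢ − Σᵢ Σ_{k<l} a(s_k(i) − s_l(i))²/aᵢ²`
is an integer. -/
theorem seifert_e_invariant_congruence
    (n : ℕ) (a : Fin n → ℕ) (ha : ∀ i, 0 < a i)
    (hcop : ∀ i j, i ≠ j → Nat.Coprime (a i) (a j))
    (b : ℤ) (c : Fin n → ℤ)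
    (hseif : -(∏ j, (a j : ℤ)) * b
        + ∑ j, (∏ k ∈ Finset.univ.erase j, (a k : ℤ)) * c j = 1)
    (c' : Fin n → ℤ)
    (hc' : ∀ i, c' i * c i ≡ 1 [ZMOD (2 * (a i : ℤ))])
    (N : ℕ) (hN : 0 < N) (s : Fin N → Fin n → ℤ) :
    ∃ m : ℤ,
      ∑ i : Fin n, ∑ k : Fin N, ∑ l ∈ Finset.univ.filter (fun l => k < l),
          ((c' i : ℚ) * ((s k i : ℚ) - (s l i : ℚ)) ^ 2 / (a i : ℚ)
            - (∏ j, (a j : ℚ)) * ((s k i : ℚ) - (s l i : ℚ)) ^ 2 / (a i : ℚ) ^ 2)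
        = (m : ℚ) := by
  have key : ∀ i, ∃ t : ℤ, c' i - ∏ k ∈ Finset.univ.erase i, (a k : ℤ) = a i * t := by
    intro i
    have h1 : (a i : ℤ) ∣ ∏ j, (a j : ℤ) := Finset.dvd_prod_of_mem _ (Finset.mem_univ i)
    have h2 : (a i : ℤ) ∣ ∑ j ∈ Finset.univ.erase i,
        (∏ k ∈ Finset.univ.erase j, (a k : ℤ)) * c j := by
      apply Finset.dvd_sum
      intro j hj
      apply Dvd.dvd.mul_right
      exact Finset.dvd_prod_of_mem (fun k => (a k : ℤ))
        (Finset.mem_erase.2 ⟨(Finset.ne_of_mem_erase hj).symm, Finset.mem_univ i⟩)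
    rw [← Finset.add_sum_erase _ _ (Finset.mem_univ i)] at hseif
    obtain ⟨u, hu⟩ := h1
    obtain ⟨v, hv⟩ := h2
    obtain ⟨w, hw⟩ := (hc' i).dvd
    rw [hu, hv] at hseif
    refine ⟨c' i * (-u * b + v) - (∏ k ∈ Finset.univ.erase i, (a k : ℤ)) * (2 * w), ?_⟩
    linear_combination (-c' i) * hseif - (∏ k ∈ Finset.univ.erase i, (a k : ℤ)) * hw
  choose t ht using key
  refine ⟨∑ i : Fin n, ∑ k : Fin N, ∑ l ∈ Finset.univ.filter (fun l => k < l),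
    t i * (s k i - s l i) ^ 2, ?_⟩
  push_cast
  refine Finset.sum_congr rfl fun i _ => Finset.sum_congr rfl fun k _ =>
    Finset.sum_congr rfl fun l _ => ?_
  have hne : (a i : ℚ) ≠ 0 := by exact_mod_cast (ha i).ne'
  have h := congrArg (fun z : ℤ => (z : ℚ)) (ht i)
  push_cast at h
  rw [← Finset.mul_prod_erase _ _ (Finset.mem_univ i)]
  field_simp
  linear_combination ((s k i : ℚ) - s l i) ^ 2 * h
end
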